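/- Let L be a finite nonempty lattice. Define a preorder ⪯ on the set Jir(L) of nonzero join-irreducible elements of L by p ⪯ q if and only if con(p_*, p) ⊆ con(q_*, q), where p_* denotes the unique lower cover of p. Then the poset of congruences of L ordered by inclusion is order-isomorphic to the poset of hereditary (downward closed) subsets of the preordered set (Jir(L), ⪯), ordered by set inclusion. -/

import Mathlib

/-- A lattice congruence: an equivalence relation compatible with join and meet. -/
def IsLatCongr {L : Type*} [Lattice L] (θ : L → L → Prop) : Prop :=
  Equivalence θ ∧
    ∀ a b c d : L, θ a b → θ c d → θ (a ⊔ c) (b ⊔ d) ∧ θ (a ⊓ c) (b ⊓ d)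

/-- `latConGen a b` is the smallest congruence collapsing `a` and `b`. -/
def latConGen {L : Type*} [Lattice L] (a b : L) : L → L → Prop :=
  fun x y => ∀ θ : L → L → Prop, IsLatCongr θ → θ a b → θ x y

/-- The preorder `q ⪯ p` on join-irreducible elements:
`con(q_*, q) ⊆ con(p_*, p)`, where `q_* ⋖ q` and `p_* ⋖ p` are the (unique) lower
covers. -/
def JirLe {L : Type*} [Lattice L] (q p : {x : L // SupIrred x}) : Prop :=
  ∃ q' p' : L, q' ⋖ q.1 ∧ p' ⋖ p.1 ∧
    ∀ x y : L, latConGen q' q.1 x y → latConGen p' p.1 x y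

namespace IsLatCongr

variable {L : Type*} [Lattice L] {θ : L → L → Prop}

theorem sup_right (h : IsLatCongr θ) {a b : L} (hab : θ a b) (c : L) : θ (a ⊔ c) (b ⊔ c) :=
  (h.2 a b c c hab (h.1.refl c)).1

theorem inf_right (h : IsLatCongr θ) {a b : L} (hab : θ a b) (c : L) : θ (a ⊓ c) (b ⊓ c) :=
  (h.2 a b c c hab (h.1.refl c)).2

theorem inf_sup (h : IsLatCongr θ) {a b : L} (hab : θ a b) : θ (a ⊓ b) (a ⊔ b) := by
  have h₁ := h.inf_right hab b
  have h₂ := h.sup_right hab b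
  rw [inf_idem] at h₁
  rw [sup_idem] at h₂
  exact h.1.trans h₁ (h.1.symm h₂)

theorem of_inf_sup (h : IsLatCongr θ) {a b : L} (hab : θ (a ⊓ b) (a ⊔ b)) : θ a b := by
  have h₁ := h.sup_right hab a
  have h₂ := h.sup_right hab b
  rw [sup_eq_right.2 inf_le_left, sup_eq_left.2 le_sup_left] at h₁
  rw [sup_eq_right.2 inf_le_right, sup_eq_left.2 le_sup_right] at h₂
  exact h.1.trans h₁ (h.1.symm h₂)

end IsLatCongr

section Congruences

variable {L : Type*} [Lattice L]

theorem isLatCongr_latConGen (a b : L) : IsLatCongr (latConGen a b) :=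
  ⟨⟨fun x _ hθ _ => hθ.1.refl x, fun h θ hθ hab => hθ.1.symm (h θ hθ hab),
    fun h₁ h₂ θ hθ hab => hθ.1.trans (h₁ θ hθ hab) (h₂ θ hθ hab)⟩,
    fun a b c d h₁ h₂ => ⟨fun θ hθ hab => (hθ.2 a b c d (h₁ θ hθ hab) (h₂ θ hθ hab)).1,
      fun θ hθ hab => (hθ.2 a b c d (h₁ θ hθ hab) (h₂ θ hθ hab)).2⟩⟩

theorem latConGen_self (a b : L) : latConGen a b a b := fun _ _ hab => hab

/-- The equivalence relation generated by a relation stable under translations is a congruence. -/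
theorem isLatCongr_eqvGen {r : L → L → Prop}
    (hsup : ∀ a b c, r a b → r (a ⊔ c) (b ⊔ c)) (hinf : ∀ a b c, r a b → r (a ⊓ c) (b ⊓ c)) :
    IsLatCongr (Relation.EqvGen r) := by
  have translate {f : L → L} (hf : ∀ a b, r a b → r (f a) (f b)) {a b : L}
      (h : Relation.EqvGen r a b) : Relation.EqvGen r (f a) (f b) := by
    induction h with
    | rel a b h => exact .rel _ _ (hf a b h)
    | refl a => exact .refl _
    | symm a b _ ih => exact .symm _ _ ih
    | trans a b c _ _ ih₁ ih₂ => exact .trans _ _ _ ih₁ ih₂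
  refine ⟨Relation.EqvGen.is_equivalence r, fun a b c d hab hcd => ⟨?_, ?_⟩⟩
  · refine .trans _ _ _ (translate (f := (· ⊔ c)) (fun a b => hsup a b c) hab) ?_
    rw [sup_comm b, sup_comm b]
    exact translate (f := (· ⊔ b)) (fun c d => hsup c d b) hcd
  · refine .trans _ _ _ (translate (f := (· ⊓ c)) (fun a b => hinf a b c) hab) ?_
    rw [inf_comm b, inf_comm b]
    exact translate (f := (· ⊓ b)) (fun c d => hinf c d b) hcd

theorem SupIrred.le_of_covBy_of_lt {p c a : L} (hp : SupIrred p) (hc : c ⋖ p) (ha : a < p) :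
    a ≤ c := by
  rcases hc.eq_or_eq le_sup_left (sup_le hc.le ha.le : c ⊔ a ≤ p) with h | h
  · exact sup_eq_left.1 h
  · exact ((hp.2 h).elim hc.ne ha.ne).elim

theorem SupIrred.covBy_unique {p c d : L} (hp : SupIrred p) (hc : c ⋖ p) (hd : d ⋖ p) : c = d :=
  le_antisymm (hp.le_of_covBy_of_lt hd hc.lt) (hp.le_of_covBy_of_lt hc hd.lt)

theorem SupIrred.exists_covBy [Finite L] {p : L} (hp : SupIrred p) : ∃ c, c ⋖ p := by
  obtain ⟨a, ha⟩ := not_isMin_iff.1 hp.1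
  obtain ⟨c, -, hc⟩ := exists_le_covBy_of_lt ha
  exact ⟨c, hc⟩

/-- If `b ≰ c`, some join-irreducible lies below `b` but not below `c`, while everything strictly
below it lies below `c`. -/
theorem exists_supIrred_le_not_le [Finite L] {b c : L} (h : ¬ b ≤ c) :
    ∃ p, SupIrred p ∧ p ≤ b ∧ ¬ p ≤ c ∧ ∀ a < p, a ≤ c := by
  obtain ⟨p, hp, hmin⟩ := WellFounded.has_min (wellFounded_lt (α := L))
    {x | x ≤ b ∧ ¬ x ≤ c} ⟨b, le_rfl, h⟩
  have hlt : ∀ a < p, a ≤ c := fun a ha => by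
    by_contra hac
    exact hmin a ⟨ha.le.trans hp.1, hac⟩ ha
  refine ⟨p, ⟨fun hm => hp.2 ((hm inf_le_left).trans (inf_le_right : p ⊓ c ≤ c)), ?_⟩,
    hp.1, hp.2, hlt⟩
  intro x y hxy
  by_contra! hne
  have hx : x ≤ p := hxy ▸ le_sup_left
  have hy : y ≤ p := hxy ▸ le_sup_right
  exact hp.2 (hxy ▸ sup_le (hlt x (lt_of_le_of_ne hx hne.1)) (hlt y (lt_of_le_of_ne hy hne.2)))

/-- The join-irreducibles which a relation identifies with their lower cover. -/
def collapsedJir (θ : L → L → Prop) : Set {x : L // SupIrred x} :=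
  {p | ∃ c, c ⋖ p.1 ∧ θ c p.1}

theorem collapsedJir_hereditary {θ : L → L → Prop} (hθ : IsLatCongr θ) :
    ∀ p ∈ collapsedJir θ, ∀ q, JirLe q p → q ∈ collapsedJir θ := by
  rintro p ⟨c, hc, hcp⟩ q ⟨q', p', hq', hp', hle⟩
  obtain rfl := p.2.covBy_unique hc hp'
  exact ⟨q', hq', hle _ _ (latConGen_self _ _) θ hθ hcp⟩

theorem IsLatCongr.le_of_collapsedJir_subset [Finite L] {θ ψ : L → L → Prop}
    (hθ : IsLatCongr θ) (hψ : IsLatCongr ψ) (hsub : collapsedJir θ ⊆ collapsedJir ψ)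
    {x y : L} (hxy : θ x y) : ψ x y := by
  apply hψ.of_inf_sup
  have hab := hθ.inf_sup hxy
  have hle : x ⊓ y ≤ x ⊔ y := inf_le_sup
  generalize x ⊓ y = a, x ⊔ y = b at hab hle
  obtain ⟨c, ⟨hac, hcb, hψc⟩, hmax⟩ := WellFounded.has_min (wellFounded_gt (α := L))
    {c | a ≤ c ∧ c ≤ b ∧ ψ a c} ⟨a, le_rfl, hle, hψ.1.refl a⟩
  by_cases hbc : b ≤ c
  · rwa [le_antisymm hbc hcb]
  exfalso
  obtain ⟨p, hp, hpb, hpc, hlt⟩ := exists_supIrred_le_not_le hbc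
  obtain ⟨d, hd⟩ := hp.exists_covBy
  have hdc := hlt d hd.lt
  have hinf : c ⊓ p = d := le_antisymm
    (hp.le_of_covBy_of_lt hd (lt_of_le_of_ne inf_le_right fun h => hpc (inf_eq_right.1 h)))
    (le_inf hdc hd.le)
  have hθcb : θ c b := by
    have := hθ.sup_right hab c
    rw [sup_eq_right.2 hac, sup_eq_left.2 hcb] at this
    exact this
  have hθdp : θ d p := by
    have := hθ.inf_right hθcb p
    rwa [hinf, inf_eq_right.2 hpb] at this
  obtain ⟨d', hd', hψd⟩ := hsub (a := ⟨p, hp⟩) ⟨d, hd, hθdp⟩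
  obtain rfl := hp.covBy_unique hd hd'
  have hψcp := hψ.sup_right hψd c
  rw [sup_eq_right.2 hdc] at hψcp
  exact hmax (p ⊔ c) ⟨hac.trans le_sup_right, sup_le hpb hcb, hψ.1.trans hψc hψcp⟩
    (lt_of_le_of_ne le_sup_right fun h => hpc (h ▸ le_sup_left))

theorem exists_isLatCongr_collapsedJir_eq [Finite L] {X : Set {x : L // SupIrred x}}
    (hX : ∀ p ∈ X, ∀ q, JirLe q p → q ∈ X) :
    ∃ θ : L → L → Prop, IsLatCongr θ ∧ collapsedJir θ = X := by
  let r : L → L → Prop := fun x y => ∃ p ∈ X, ∃ c, c ⋖ p.1 ∧ latConGen c p.1 x y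
  have hsup : ∀ a b c, r a b → r (a ⊔ c) (b ⊔ c) := fun a b c ⟨p, hp, d, hd, h⟩ =>
    ⟨p, hp, d, hd, (isLatCongr_latConGen _ _).sup_right h c⟩
  have hinf : ∀ a b c, r a b → r (a ⊓ c) (b ⊓ c) := fun a b c ⟨p, hp, d, hd, h⟩ =>
    ⟨p, hp, d, hd, (isLatCongr_latConGen _ _).inf_right h c⟩
  refine ⟨Relation.EqvGen r, isLatCongr_eqvGen hsup hinf, Set.Subset.antisymm ?_ ?_⟩
  · rintro q ⟨c, hc, hcq⟩
    have separated {x y : L} (h : Relation.EqvGen r x y) :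
        x ⊓ q.1 ⊔ c ≠ y ⊓ q.1 ⊔ c → q ∈ X := by
      induction h with
      | rel x y h =>
        intro hne
        obtain ⟨p, hp, d, hd, hxy⟩ := hsup _ _ c (hinf _ _ q.1 h)
        have two (z : L) : z ⊓ q.1 ⊔ c = c ∨ z ⊓ q.1 ⊔ c = q.1 :=
          hc.eq_or_eq le_sup_right (sup_le inf_le_right hc.le)
        have hcong := isLatCongr_latConGen d p.1
        have hdp : latConGen d p.1 c q.1 := by
          rcases two x with hx | hx <;> rcases two y with hy | hy <;> rw [hx, hy] at hxy hne
          · exact (hne rfl).elim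
          · exact hxy
          · exact hcong.1.symm hxy
          · exact (hne rfl).elim
        exact hX p hp q ⟨c, d, hc, hd, fun u v huv => huv _ hcong hdp⟩
      | refl x => exact fun hne => (hne rfl).elim
      | symm x y _ ih => exact fun hne => ih hne.symm
      | trans x y z _ _ ih₁ ih₂ =>
        intro hne
        by_cases hxy : x ⊓ q.1 ⊔ c = y ⊓ q.1 ⊔ c
        · exact ih₂ (hxy ▸ hne)
        · exact ih₁ hxy
    apply separated hcq
    rw [inf_eq_left.2 hc.le, sup_idem, inf_idem, sup_eq_left.2 hc.le]
    exact hc.ne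
  · intro p hp
    obtain ⟨c, hc⟩ := p.2.exists_covBy
    exact ⟨c, hc, .rel _ _ ⟨p, hp, c, hc, latConGen_self _ _⟩⟩

end Congruences

/-- For a finite nonempty lattice `L`, the poset of congruences of `L`
ordered by inclusion is order-isomorphic to the poset of hereditary (downward closed)
subsets of the preordered set `(Jir(L), ⪯)`, ordered by set inclusion, where
`p ⪯ q ↔ con(p_*, p) ⊆ con(q_*, q)`. -/
theorem congr_orderIso_hereditary
    {L : Type*} [Lattice L] [Fintype L] [Nonempty L] :
    ∃ e : {θ : L → L → Prop // IsLatCongr θ} ≃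
        {X : Set {x : L // SupIrred x} // ∀ p ∈ X, ∀ q, JirLe q p → q ∈ X},
      ∀ θ₁ θ₂ : {θ : L → L → Prop // IsLatCongr θ},
        (∀ x y : L, θ₁.1 x y → θ₂.1 x y) ↔ (e θ₁).1 ⊆ (e θ₂).1 := by
  have hiff (θ₁ θ₂ : {θ : L → L → Prop // IsLatCongr θ}) :
      (∀ x y : L, θ₁.1 x y → θ₂.1 x y) ↔ collapsedJir θ₁.1 ⊆ collapsedJir θ₂.1 :=
    ⟨fun h _ ⟨c, hc, hcp⟩ => ⟨c, hc, h _ _ hcp⟩,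
      fun h _ _ hxy => θ₁.2.le_of_collapsedJir_subset θ₂.2 h hxy⟩
  refine ⟨Equiv.ofBijective
    (fun θ => ⟨collapsedJir θ.1, collapsedJir_hereditary θ.2⟩) ⟨?_, ?_⟩, hiff⟩
  · intro θ₁ θ₂ h
    have h' : collapsedJir θ₁.1 = collapsedJir θ₂.1 := congrArg Subtype.val h
    ext x y
    exact ⟨(hiff θ₁ θ₂).2 h'.subset x y, (hiff θ₂ θ₁).2 h'.symm.subset x y⟩
  · rintro ⟨X, hX⟩
    obtain ⟨θ, hθ, rfl⟩ := exists_isLatCongr_collapsedJir_eq hX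
    exact ⟨⟨θ, hθ⟩, rfl⟩
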